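/- Let G be a finite simple graph on n vertices with |e(G)| edges and first Zagreb index M1(G). Then both LE_CN(G) and LE⁺_CN(G) are bounded above by 2(1 - 1/n)(M1(G) - 2|e(G)|). -/

import Mathlib

set_option linter.unusedSectionVars false

open Matrix BigOperators Finset

namespace CNE

variable {V : Type*} [Fintype V]

/-- The common neighborhood matrix `CN(G)`. -/
noncomputable def cn [DecidableEq V] (G : SimpleGraph V) : Matrix V V ℝ :=
  Matrix.of fun i j => if i = j then 0 else (Nat.card (G.commonNeighbors i j) : ℝ)

/-- The common neighborhood row sum (diagonal) matrix `CNRS(G)`. -/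
noncomputable def cnrs [DecidableEq V] (G : SimpleGraph V) : Matrix V V ℝ :=
  Matrix.diagonal fun i => ∑ j, cn G i j

/-- The common neighborhood Laplacian matrix `CNL(G) = CNRS(G) - CN(G)`. -/
noncomputable def cnl [DecidableEq V] (G : SimpleGraph V) : Matrix V V ℝ :=
  cnrs G - cn G

/-- The common neighborhood signless Laplacian matrix `CNSL(G) = CNRS(G) + CN(G)`. -/
noncomputable def cnsl [DecidableEq V] (G : SimpleGraph V) : Matrix V V ℝ :=
  cnrs G + cn G

lemma cn_isHermitian [DecidableEq V] (G : SimpleGraph V) : (cn G).IsHermitian := by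
  ext i j
  simp only [Matrix.conjTranspose_apply, cn, Matrix.of_apply, star_trivial]
  rw [SimpleGraph.commonNeighbors_symm]
  by_cases h : i = j
  · simp [h]
  · rw [if_neg h, if_neg fun hji => h hji.symm]

lemma cnrs_isHermitian [DecidableEq V] (G : SimpleGraph V) : (cnrs G).IsHermitian :=
  Matrix.isHermitian_diagonal _

lemma cnl_isHermitian [DecidableEq V] (G : SimpleGraph V) : (cnl G).IsHermitian :=
  (cnrs_isHermitian G).sub (cn_isHermitian G)

lemma cnsl_isHermitian [DecidableEq V] (G : SimpleGraph V) : (cnsl G).IsHermitian :=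
  (cnrs_isHermitian G).add (cn_isHermitian G)

/-- The common neighborhood energy `E_CN(G)`: the sum of the absolute values of the
eigenvalues (with multiplicity) of `CN(G)`. -/
noncomputable def Ecn [DecidableEq V] (G : SimpleGraph V) : ℝ :=
  ∑ i, |(cn_isHermitian G).eigenvalues i|

/-- The common neighborhood Laplacian energy `LE_CN(G)`. -/
noncomputable def LEcn [DecidableEq V] (G : SimpleGraph V) : ℝ :=
  ∑ i, |(cnl_isHermitian G).eigenvalues i - (cnrs G).trace / (Fintype.card V : ℝ)|

/-- The common neighborhood signless Laplacian energy `LE⁺_CN(G)`. -/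
noncomputable def LEpcn [DecidableEq V] (G : SimpleGraph V) : ℝ :=
  ∑ i, |(cnsl_isHermitian G).eigenvalues i - (cnrs G).trace / (Fintype.card V : ℝ)|

open Classical in
/-- The (real) adjacency matrix of a graph, defined classically. -/
noncomputable def adjMat (G : SimpleGraph V) : Matrix V V ℝ :=
  Matrix.of fun i j => if G.Adj i j then 1 else 0

lemma adjMat_isHermitian (G : SimpleGraph V) : (adjMat G).IsHermitian := by
  ext i j
  simp only [Matrix.conjTranspose_apply, adjMat, Matrix.of_apply, star_trivial]
  by_cases h : G.Adj i j
  · simp [h, h.symm]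
  · have h' : ¬ G.Adj j i := fun hji => h hji.symm
    simp [h, h']

/-- The diagonal degree matrix of a graph. -/
noncomputable def degMat [DecidableEq V] (G : SimpleGraph V) : Matrix V V ℝ :=
  Matrix.diagonal fun v => (Nat.card (G.neighborSet v) : ℝ)

/-- The Laplacian matrix `L(G) = D(G) - A(G)`. -/
noncomputable def lap [DecidableEq V] (G : SimpleGraph V) : Matrix V V ℝ :=
  degMat G - adjMat G

/-- The signless Laplacian matrix `Q(G) = D(G) + A(G)`. -/
noncomputable def slap [DecidableEq V] (G : SimpleGraph V) : Matrix V V ℝ :=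
  degMat G + adjMat G

lemma degMat_isHermitian [DecidableEq V] (G : SimpleGraph V) : (degMat G).IsHermitian :=
  Matrix.isHermitian_diagonal _

lemma lap_isHermitian [DecidableEq V] (G : SimpleGraph V) : (lap G).IsHermitian :=
  (degMat_isHermitian G).sub (adjMat_isHermitian G)

lemma slap_isHermitian [DecidableEq V] (G : SimpleGraph V) : (slap G).IsHermitian :=
  (degMat_isHermitian G).add (adjMat_isHermitian G)

/-- The energy `E(G)` of a graph: the sum of the absolute values of the eigenvalues
(with multiplicity) of the adjacency matrix. -/
noncomputable def energy [DecidableEq V] (G : SimpleGraph V) : ℝ :=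
  ∑ i, |(adjMat_isHermitian G).eigenvalues i|

/-- The Laplacian energy `LE(G)`. -/
noncomputable def LE [DecidableEq V] (G : SimpleGraph V) : ℝ :=
  ∑ i, |(lap_isHermitian G).eigenvalues i - (degMat G).trace / (Fintype.card V : ℝ)|

/-- The signless Laplacian energy `LE⁺(G)`. -/
noncomputable def LEp [DecidableEq V] (G : SimpleGraph V) : ℝ :=
  ∑ i, |(slap_isHermitian G).eigenvalues i - (degMat G).trace / (Fintype.card V : ℝ)|

/-- The derived graph `G†`: two vertices are adjacent iff their distance in `G` is two. -/
def derivedGraph (G : SimpleGraph V) : SimpleGraph V where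
  Adj u v := G.dist u v = 2
  symm := by
    constructor
    intro u v h
    show G.dist v u = 2
    rwa [SimpleGraph.dist_comm]
  loopless := by
    constructor
    intro v h
    simp [SimpleGraph.dist_self] at h

lemma cn_eq [DecidableEq V] (G : SimpleGraph V) [DecidableRel G.Adj] (i j : V) :
    cn G i j = (∑ k, (if G.Adj k i then (1 : ℝ) else 0) * (if G.Adj k j then (1 : ℝ) else 0))
      - (if i = j then (G.degree i : ℝ) else 0) := by
  have hd : ∀ v, (G.degree v : ℝ) = ∑ k, (if G.Adj k v then (1 : ℝ) else 0) := by
    intro v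
    rw [← SimpleGraph.card_neighborFinset_eq_degree, SimpleGraph.neighborFinset_eq_filter]
    simp [SimpleGraph.adj_comm]
  by_cases h : i = j
  · subst h
    simp only [cn, Matrix.of_apply, if_true, hd]
    rw [eq_comm, sub_eq_zero]
    apply Finset.sum_congr rfl
    intro k _
    by_cases h1 : G.Adj k i <;> simp [h1]
  · simp only [cn, Matrix.of_apply, if_neg h, sub_zero]
    have : Nat.card (G.commonNeighbors i j) =
        (Finset.univ.filter fun k => G.Adj k i ∧ G.Adj k j).card := by
      rw [← Fintype.card_subtype, ← Nat.card_eq_fintype_card]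
      apply Nat.card_congr
      apply Equiv.subtypeEquivRight
      intro k
      simp [SimpleGraph.mem_commonNeighbors, SimpleGraph.adj_comm]
    rw [this, Finset.card_filter]
    push_cast
    apply Finset.sum_congr rfl
    intro k _
    by_cases h1 : G.Adj k i <;> by_cases h2 : G.Adj k j <;> simp [h1, h2]

lemma trace_cnrs [DecidableEq V] (G : SimpleGraph V) [DecidableRel G.Adj] :
    (cnrs G).trace = (∑ v, (G.degree v : ℝ) ^ 2) - 2 * (G.edgeFinset.card : ℝ) := by
  have hd : ∀ v, (G.degree v : ℝ) = ∑ k, (if G.Adj v k then (1 : ℝ) else 0) := by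
    intro v
    rw [← SimpleGraph.card_neighborFinset_eq_degree, SimpleGraph.neighborFinset_eq_filter]
    simp
  have he : 2 * (G.edgeFinset.card : ℝ) = ∑ v, (G.degree v : ℝ) := by
    exact_mod_cast G.sum_degrees_eq_twice_card_edges.symm
  rw [he]
  simp only [cnrs, Matrix.trace_diagonal, cn_eq, Finset.sum_sub_distrib, Finset.sum_ite_eq,
    Finset.mem_univ, if_true]
  congr 1
  simp_rw [sq, hd, Finset.sum_mul_sum]
  rw [Finset.sum_comm' (t' := Finset.univ) (s' := fun _ => Finset.univ) (by simp)]
  rw [Finset.sum_congr rfl (fun j _ => Finset.sum_comm)]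
  rw [Finset.sum_comm]
  exact Finset.sum_congr rfl fun k _ => Finset.sum_comm

lemma cn_nonneg [DecidableEq V] (G : SimpleGraph V) (i j : V) : 0 ≤ cn G i j := by
  simp only [cn, Matrix.of_apply]
  split_ifs <;> positivity

lemma cn_self [DecidableEq V] (G : SimpleGraph V) (i : V) : cn G i i = 0 := by
  simp [cn]

lemma energy_bound [DecidableEq V] (G : SimpleGraph V) {M : Matrix V V ℝ} (hM : M.IsHermitian)
    (hdiag : ∀ i, M i i = ∑ j, cn G i j) (hoff : ∀ i j, i ≠ j → |M i j| = cn G i j) :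
    ∑ i, |hM.eigenvalues i - (cnrs G).trace / (Fintype.card V : ℝ)| ≤
      2 * (1 - 1 / (Fintype.card V : ℝ)) * (cnrs G).trace := by
  have hnn : ∀ i, 0 ≤ hM.eigenvalues i := by
    intro i
    have h1 := hM.eigenvalues_mem_spectrum_real i
    rw [← Matrix.spectrum_toLin', ← Module.End.hasEigenvalue_iff_mem_spectrum] at h1
    obtain ⟨k, hk⟩ := eigenvalue_mem_ball h1
    rw [Metric.mem_closedBall, Real.dist_eq, hdiag] at hk
    have h2 : ∑ j ∈ Finset.univ.erase k, ‖M k j‖ = ∑ j, cn G k j := by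
      rw [← Finset.add_sum_erase _ _ (Finset.mem_univ k), cn_self, zero_add]
      exact Finset.sum_congr rfl fun j hj => hoff k j (Finset.ne_of_mem_erase hj).symm
    rw [h2] at hk
    linarith [(abs_le.mp hk).1]
  have htr : ∑ i, hM.eigenvalues i = (cnrs G).trace := by
    have := hM.trace_eq_sum_eigenvalues
    simp only [RCLike.ofReal_real_eq_id, id_eq] at this
    rw [← this]
    simp [Matrix.trace, hdiag, cnrs]
  generalize (cnrs G).trace = T at *
  generalize hM.eigenvalues = e at *
  rcases isEmpty_or_nonempty V with hV | hV
  · simp at htr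
    simp [← htr]
  have hn : (0 : ℝ) < Fintype.card V := by exact_mod_cast Fintype.card_pos
  set m := T / (Fintype.card V : ℝ) with hm
  have hT : T = Fintype.card V * m := by rw [hm]; field_simp
  have hm0 : 0 ≤ m := div_nonneg (htr ▸ Finset.sum_nonneg fun i _ => hnn i) hn.le
  obtain ⟨i0, -, hi0⟩ : ∃ i ∈ Finset.univ, m ≤ e i := by
    apply Finset.exists_le_of_sum_le Finset.univ_nonempty
    rw [htr]
    simp [hT]
  have hb : ∑ i, |e i - m| ≤ ∑ i, (e i + m - if i = i0 then 2 * m else 0) := by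
    apply Finset.sum_le_sum
    intro i _
    split_ifs with h
    · subst h
      rw [abs_of_nonneg (by linarith)]
      linarith
    · rw [abs_le]
      constructor <;> linarith [hnn i]
  refine hb.trans (le_of_eq ?_)
  rw [Finset.sum_sub_distrib, Finset.sum_add_distrib, htr]
  simp only [Finset.sum_const, Finset.card_univ, nsmul_eq_mul, Finset.sum_ite_eq', Finset.mem_univ,
    if_true]
  rw [← hT, hm]
  ring

theorem statement18 [DecidableEq V] (G : SimpleGraph V) [DecidableRel G.Adj] :
    LEcn G ≤ 2 * (1 - 1 / (Fintype.card V : ℝ)) *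
        ((∑ v, (G.degree v : ℝ) ^ 2) - 2 * (G.edgeFinset.card : ℝ)) ∧
    LEpcn G ≤ 2 * (1 - 1 / (Fintype.card V : ℝ)) *
        ((∑ v, (G.degree v : ℝ) ^ 2) - 2 * (G.edgeFinset.card : ℝ)) := by
  rw [← trace_cnrs]
  constructor
  · apply energy_bound G (cnl_isHermitian G)
    · intro i
      simp [cnl, cnrs, cn_self]
    · intro i j h
      simp [cnl, cnrs, h, abs_of_nonneg (cn_nonneg G i j)]
  · apply energy_bound G (cnsl_isHermitian G)
    · intro i
      simp [cnsl, cnrs, cn_self]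
    · intro i j h
      simp [cnsl, cnrs, h, abs_of_nonneg (cn_nonneg G i j)]

end CNE
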